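/- For every n ≥ 3 and every real root λ̄ of the polynomial a_{n−1}, the three-dimensional real subspace I_λ̄ := span_ℝ{X̂, Ŷ, Ẑ} is a Lie ideal of the dynamical Lie algebra ℒ, i.e. [ℒ, I_λ̄] ⊆ I_λ̄. -/

import Mathlib

namespace Ising

noncomputable section

open Matrix

attribute [local instance 100] LieRing.ofAssociativeRing

/-- We model `2^n × 2^n` complex matrices as matrices indexed by `Fin n → Fin 2`
(the standard index type for an `n`-fold tensor product of qubits). -/
abbrev M (n : ℕ) := Matrix (Fin n → Fin 2) (Fin n → Fin 2) ℂ

/-- The Pauli matrix σx. -/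
def sx : Matrix (Fin 2) (Fin 2) ℂ := !![0, 1; 1, 0]
/-- The Pauli matrix σy. -/
def sy : Matrix (Fin 2) (Fin 2) ℂ := !![0, Complex.I; -Complex.I, 0]
/-- The Pauli matrix σz. -/
def sz : Matrix (Fin 2) (Fin 2) ℂ := !![1, 0; 0, -1]

/-- The `n`-fold Kronecker product of the `2 × 2` matrices `f 0, …, f (n-1)`. -/
def kron {n : ℕ} (f : Fin n → Matrix (Fin 2) (Fin 2) ℂ) : M n :=
  fun x y => ∏ j, f j (x j) (y j)

/-- The matrix `σ` placed in the `j`-th tensor factor, identity elsewhere (`σ^j`). -/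
def pauliAt (n : ℕ) (σ : Matrix (Fin 2) (Fin 2) ℂ) (j : Fin n) : M n :=
  kron fun i => if i = j then σ else 1

/-- The permutation matrix implementing the cyclic shift of the `n` tensor factors. -/
def P (n : ℕ) : M n :=
  fun x y => if x = (fun i => y (finRotate n i)) then 1 else 0

/-- The symmetrizer `C(A) = ∑_{k=0}^{n-1} Pᵏ A (Pᵏ)⁻¹` over the cyclic group `C_n`. -/
def symmC {n : ℕ} (A : M n) : M n :=
  ∑ k ∈ Finset.range n, P n ^ k * A * (P n ^ k)⁻¹

/-- The Pauli string `a ⊗ σx^{⊗j} ⊗ b ⊗ 1^{⊗(n-j-2)}`. -/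
def str (n : ℕ) (a b : Matrix (Fin 2) (Fin 2) ℂ) (j : ℕ) : M n :=
  kron fun i => if (i : ℕ) = 0 then a else if (i : ℕ) = j + 1 then b
    else if (i : ℕ) ≤ j then sx else 1

/-- `Y^j := i C(σy ⊗ σx^{⊗j} ⊗ σy ⊗ 1^{⊗(n-j-2)})`. -/
def Y (n j : ℕ) : M n := Complex.I • symmC (str n sy sy j)
/-- `Z^j := i C(σz ⊗ σx^{⊗j} ⊗ σz ⊗ 1^{⊗(n-j-2)})`. -/
def Z (n j : ℕ) : M n := Complex.I • symmC (str n sz sz j)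
/-- `YZ^j := i C(σz ⊗ σx^{⊗j} ⊗ σy ⊗ 1^{⊗(n-j-2)}) + i C(σy ⊗ σx^{⊗j} ⊗ σz ⊗ 1^{⊗(n-j-2)})`. -/
def YZ (n j : ℕ) : M n :=
  Complex.I • symmC (str n sz sy j) + Complex.I • symmC (str n sy sz j)
/-- `X := i C(σx ⊗ 1^{⊗(n-1)})`. -/
def X (n : ℕ) : M n :=
  Complex.I • symmC (kron fun i : Fin n => if (i : ℕ) = 0 then sx else 1)
/-- `XX := i C(σx^{⊗(n-1)} ⊗ 1)`. -/
def XX (n : ℕ) : M n :=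
  Complex.I • symmC (kron fun i : Fin n => if (i : ℕ) = n - 1 then 1 else sx)

/-- `H0 = ∑_{j=1}^{n-1} σz^j σz^{j+1} + σz^n σz^1` (cyclically next neighbours). -/
def H0 (n : ℕ) : M n := ∑ j : Fin n, pauliAt n sz j * pauliAt n sz (finRotate n j)
/-- `H1 = ∑_{j=1}^{n} σx^j`. -/
def H1 (n : ℕ) : M n := ∑ j : Fin n, pauliAt n sx j

/-- The dynamical Lie algebra: the smallest real Lie subalgebra of the `2^n × 2^n`
complex matrices (with the commutator bracket) containing `i•H0` and `i•H1`. -/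
def DLA (n : ℕ) : LieSubalgebra ℝ (M n) :=
  LieSubalgebra.lieSpan ℝ (M n) {Complex.I • H0 n, Complex.I • H1 n}

/-- The polynomials `a_k(λ)`, defined by `a₋₁ = 0`, `a₀ = 1`, `a_k = λ a_{k-1} - a_{k-2}`
(so `a 1 = λ·a₀ - a₋₁ = λ`). -/
def aSeq (lam : ℝ) : ℕ → ℝ
  | 0 => 1
  | 1 => lam
  | k + 2 => lam * aSeq lam (k + 1) - aSeq lam k

/-- `X̂ = a₀(X + Z¹) + a_{n-2}(λ̄)(XX - Y^{n-3}) + ∑_{k=1}^{n-3} a_k(λ̄)(Z^{k+1} - Y^{k-1})`. -/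
def Xhat (n : ℕ) (lam : ℝ) : M n :=
  (X n + Z n 1) + aSeq lam (n - 2) • (XX n - Y n (n - 3)) +
    ∑ k ∈ Finset.Icc 1 (n - 3), aSeq lam k • (Z n (k + 1) - Y n (k - 1))

/-- `Ŷ = ∑_{k=0}^{n-2} a_k(λ̄)(Y^k - Z^k)`. -/
def Yhat (n : ℕ) (lam : ℝ) : M n :=
  ∑ k ∈ Finset.range (n - 1), aSeq lam k • (Y n k - Z n k)

/-- `Ẑ = ∑_{k=0}^{n-2} a_k(λ̄) YZ^k`. -/
def Zhat (n : ℕ) (lam : ℝ) : M n :=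
  ∑ k ∈ Finset.range (n - 1), aSeq lam k • YZ n k

/-- `I_λ̄ = span_ℝ {X̂, Ŷ, Ẑ}`. -/
def Ideal (n : ℕ) (lam : ℝ) : Submodule ℝ (M n) :=
  Submodule.span ℝ {Xhat n lam, Yhat n lam, Zhat n lam}

section Helpers
set_option linter.unusedSectionVars false

abbrev Mat2 := Matrix (Fin 2) (Fin 2) ℂ

theorem sz_sz : sz * sz = 1 := by
  ext i j; fin_cases i <;> fin_cases j <;> simp [sz]
theorem sx_sx : sx * sx = 1 := by
  ext i j; fin_cases i <;> fin_cases j <;> simp [sx]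
theorem sx_sz : sx * sz = Complex.I • sy := by
  ext i j; fin_cases i <;> fin_cases j <;> simp [sx, sy, sz]
theorem sz_sx : sz * sx = (-Complex.I) • sy := by
  ext i j; fin_cases i <;> fin_cases j <;> simp [sx, sy, sz]
theorem sz_sx_neg : sz * sx = -(sx * sz) := by
  rw [sz_sx, sx_sz, neg_smul]
theorem sz_sy_neg : sz * sy = -(sy * sz) := by
  ext i j; fin_cases i <;> fin_cases j <;> simp [sy, sz]

/-- Alternating words `u_l v_l u_{l+1} ⋯ u_{l+k}`. -/
def W {R : Type*} [Ring R] (u v : ℕ → R) (l : ℕ) : ℕ → R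
  | 0 => u l
  | k + 1 => W u v l k * v (l + k) * u (l + k + 1)

theorem W_comm {R : Type*} [Ring R] (u v : ℕ → R) (H : R)
    (hv : ∀ k, H * v k - v k * H = 0) (hvv : ∀ k, v k * v k = 1)
    (hu : ∀ k, H * u (k + 1) - u (k + 1) * H = 2 * (v k + v (k + 1)) * u (k + 1))
    (h1 : ∀ k, v k * u k = -(u k * v k)) (l k : ℕ) :
    H * W u v (l + 1) k - W u v (l + 1) k * H =
      2 * (v l * W u v (l + 1) k) - 2 * (W u v (l + 1) k * v (l + 1 + k)) := by
  induction k with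
  | zero =>
    simp only [W, add_zero]
    rw [hu, mul_assoc, add_mul, h1 (l + 1)]
    noncomm_ring
  | succ k ih =>
    simp only [W]
    generalize W u v (l + 1) k = w at *
    have e : l + 1 + (k + 1) = l + 1 + k + 1 := by ring
    rw [e]
    have a1 := hv (l + 1 + k)
    have a2 := hu (l + 1 + k)
    have a3 := hvv (l + 1 + k)
    have a4 := h1 (l + 1 + k + 1)
    generalize v (l + 1 + k) = p at *
    generalize v (l + 1 + k + 1) = q at *
    generalize u (l + 1 + k + 1) = r at *
    have : H * (w * p * r) - w * p * r * H
      = (H * w - w * H) * p * r + w * (H * p - p * H) * r + w * p * (H * r - r * H) := by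
      noncomm_ring
    rw [this, ih, a1, a2]
    have b : w * p * (2 * (p + q) * r) = 2 * (w * (p * p) * r) + 2 * (w * p * (q * r)) := by
      noncomm_ring
    have c : (2 * (v l * w) - 2 * (w * p)) * p * r
      = 2 * (v l * (w * p * r)) - 2 * (w * (p * p) * r) := by
      noncomm_ring
    rw [b, c, a3, a4]
    noncomm_ring

theorem W_dual {R : Type*} [Ring R] (u v : ℕ → R) (l k : ℕ) :
    W u v l k * v (l + k) = u l * W v (fun i => u (i + 1)) l k := by
  induction k with
  | zero => simp [W]
  | succ k ih =>
    simp only [W]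
    rw [ih]
    simp only [mul_assoc, add_assoc]

theorem W_dual2 {R : Type*} [Ring R] (u v : ℕ → R) (l k : ℕ) :
    W u v l (k + 1) = u l * W v (fun i => u (i + 1)) l k * u (l + k + 1) := by
  simp only [W]
  rw [W_dual]

theorem W_succ_left {R : Type*} [Ring R] (u v : ℕ → R) (l k : ℕ) :
    W v (fun i => u (i + 1)) l k * u (l + k + 1) = v l * W u v (l + 1) k := by
  induction k with
  | zero => simp [W]
  | succ k ih =>
    simp only [W]
    rw [ih]
    simp only [mul_assoc, add_assoc, add_comm 1 k]

theorem sum_shift {R : Type*} [AddCommGroup R] (n : ℕ) (f : ℕ → R) (h : f n = f 0) :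
    ∑ l ∈ Finset.range n, f (l + 1) = ∑ l ∈ Finset.range n, f l := by
  have a := Finset.sum_range_succ f n
  rw [Finset.sum_range_succ', h] at a
  exact add_right_cancel a

variable {n : ℕ}

theorem kron_mul (f g : Fin n → Mat2) : kron f * kron g = kron (fun i => f i * g i) := by
  ext x y
  simp only [kron, Matrix.mul_apply, ← Finset.prod_mul_distrib]
  rw [Finset.prod_univ_sum]
  simp

theorem kron_update_smul (f : Fin n → Mat2) (j : Fin n) (c : ℂ) (A : Mat2) :
    kron (Function.update f j (c • A)) = c • kron (Function.update f j A) := by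
  ext x y
  simp only [kron, Matrix.smul_apply]
  rw [Fintype.prod_eq_mul_prod_compl j, Fintype.prod_eq_mul_prod_compl j]
  simp only [Function.update_self, Matrix.smul_apply, smul_eq_mul, mul_assoc]
  congr 2
  apply Finset.prod_congr rfl
  intro i hi
  have : i ≠ j := by simpa using hi
  simp [this]

theorem kron_mul_pauli (f : Fin n → Mat2) (j : Fin n) (A : Mat2) :
    kron f * pauliAt n A j = kron (Function.update f j (f j * A)) := by
  rw [pauliAt, kron_mul]
  congr 1
  ext1 i
  by_cases h : i = j
  · subst h; simp
  · simp [h]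

theorem pauli_mul_kron (f : Fin n → Mat2) (j : Fin n) (A : Mat2) :
    pauliAt n A j * kron f = kron (Function.update f j (A * f j)) := by
  rw [pauliAt, kron_mul]
  congr 1
  ext1 i
  by_cases h : i = j
  · subst h; simp
  · simp [h]

theorem kron_one : kron (fun _ : Fin n => (1 : Mat2)) = 1 := by
  ext x y
  simp only [kron, Matrix.one_apply]
  by_cases h : x = y
  · subst h; simp
  · rw [if_neg h]
    obtain ⟨i, hi⟩ := Function.ne_iff.mp h
    exact Finset.prod_eq_zero (Finset.mem_univ i) (by simp [hi])

theorem pauli_mul_same (j : Fin n) (A B : Mat2) :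
    pauliAt n A j * pauliAt n B j = pauliAt n (A * B) j := by
  simp only [pauliAt, kron_mul]
  congr 1
  ext1 i
  by_cases h : i = j <;> simp [h]

theorem pauli_one (j : Fin n) : pauliAt n 1 j = 1 := by
  simp only [pauliAt, ite_self, kron_one]

theorem pauli_eq (j : Fin n) (A : Mat2) :
    pauliAt n A j = kron (Function.update (fun _ => (1 : Mat2)) j A) := by
  simp only [pauliAt]
  congr 1
  ext1 i
  by_cases h : i = j <;> simp [h]

theorem pauli_smul (j : Fin n) (c : ℂ) (A : Mat2) :
    pauliAt n (c • A) j = c • pauliAt n A j := by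
  simp only [pauli_eq, kron_update_smul]

theorem pauli_comm {i j : Fin n} (h : i ≠ j) (A B : Mat2) :
    pauliAt n A i * pauliAt n B j = pauliAt n B j * pauliAt n A i := by
  simp only [pauliAt, kron_mul]
  congr 1
  ext1 k
  by_cases h1 : k = i
  · subst h1; simp [h]
  · simp [h1]

theorem pauli_anti (f : Fin n → Mat2) (j : Fin n) (A : Mat2) (h : A * f j = -(f j * A)) :
    pauliAt n A j * kron f = -(kron f * pauliAt n A j) := by
  rw [pauli_mul_kron, kron_mul_pauli, h, ← neg_one_smul ℂ (f j * A), kron_update_smul,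
    neg_one_smul]

/-! Conjugation by the cyclic shift. -/

theorem P_transpose : P n * (P n)ᵀ = 1 := by
  ext x y
  simp only [Matrix.mul_apply, Matrix.transpose_apply, P, Matrix.one_apply]
  generalize finRotate n = σ
  have key : ∀ w : Fin n → Fin 2, (x = fun i => w (σ i)) ↔
      w = fun i => x (σ.symm i) := by
    intro w
    constructor
    · rintro rfl; ext1 i; simp
    · rintro rfl; ext1 i; simp
  simp only [key, ite_mul, one_mul, zero_mul, Finset.sum_ite_eq', Finset.mem_univ, if_true,
    Equiv.symm_apply_apply]
  simp only [eq_comm]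

theorem P_mul_kron (f : Fin n → Mat2) :
    P n * kron f = kron (fun i => f (finRotate n i)) * P n := by
  ext x y
  simp only [Matrix.mul_apply, P]
  generalize finRotate n = σ
  have key : ∀ w : Fin n → Fin 2, (x = fun i => w (σ i)) ↔
      w = fun i => x (σ.symm i) := by
    intro w
    constructor
    · rintro rfl; ext1 i; simp
    · rintro rfl; ext1 i; simp
  simp only [key]
  simp [kron]
  rw [← Equiv.prod_comp σ]
  simp

theorem Ppow_mul_kron (f : Fin n → Mat2) (k : ℕ) :
    P n ^ k * kron f = kron (fun i => f ((finRotate n)^[k] i)) * P n ^ k := by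
  induction k generalizing f with
  | zero => simp
  | succ k ih =>
    rw [pow_succ, mul_assoc, P_mul_kron, ← mul_assoc, ih, mul_assoc]
    simp only [← Function.iterate_succ_apply' (finRotate n)]

theorem Ppow_isUnit (k : ℕ) : IsUnit (P n ^ k).det := by
  rw [Matrix.det_pow]
  apply IsUnit.pow
  have := congrArg Matrix.det (P_transpose (n := n))
  rw [Matrix.det_mul, Matrix.det_one] at this
  exact IsUnit.of_mul_eq_one _ this

theorem symmC_kron_aux (f : Fin n → Mat2) :
    symmC (kron f) = ∑ k ∈ Finset.range n, kron (fun i => f ((finRotate n)^[k] i)) := by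
  simp only [symmC]
  apply Finset.sum_congr rfl
  intro k _
  rw [Ppow_mul_kron, mul_assoc, Matrix.mul_nonsing_inv _ (Ppow_isUnit k), mul_one]

variable [NeZero n]

/-- Cyclic site index. -/
def cc (n : ℕ) [NeZero n] (l : ℕ) : Fin n := Fin.ofNat n l

theorem cc_val (l : ℕ) : ((cc n l : Fin n) : ℕ) = l % n := rfl

theorem cc_add (l k : ℕ) : cc n (l + k) = cc n l + cc n k := by
  apply Fin.ext
  simp [Fin.val_add, cc_val]

theorem cc_zero : cc n 0 = 0 := by
  apply Fin.ext
  simp [cc_val]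

theorem cc_n : cc n n = 0 := by
  apply Fin.ext
  simp [cc_val]

theorem cc_add_n (l : ℕ) : cc n (l + n) = cc n l := by
  rw [cc_add, cc_n, add_zero]

theorem cc_coe (i : Fin n) : cc n (i : ℕ) = i := by
  apply Fin.ext
  simp [cc_val, Nat.mod_eq_of_lt i.2]

theorem finRotate_cc (i : Fin n) : finRotate n i = i + cc n 1 := by
  obtain ⟨m, rfl⟩ : ∃ m, n = m + 1 := Nat.exists_eq_succ_of_ne_zero (NeZero.ne n)
  rw [finRotate_apply]
  rfl

theorem iter_cc (k : ℕ) (i : Fin n) : (finRotate n)^[k] i = i + cc n k := by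
  induction k generalizing i with
  | zero => simp [cc_zero]
  | succ k ih => rw [Function.iterate_succ_apply, ih, finRotate_cc, add_comm k 1, cc_add, add_assoc]

theorem sum_cc {R : Type*} [AddCommMonoid R] (f : Fin n → R) :
    ∑ l ∈ Finset.range n, f (cc n l) = ∑ l : Fin n, f l := by
  rw [Finset.sum_range]
  simp only [cc_coe]

/-- Translated string. -/
def T (f : Fin n → Mat2) (l : ℕ) : M n := kron (fun i => f (i - cc n l))

theorem symmC_kron (f : Fin n → Mat2) :
    symmC (kron f) = ∑ l ∈ Finset.range n, T f l := by
  rw [symmC_kron_aux]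
  simp only [iter_cc, T]
  rw [sum_cc (fun c => kron (fun i => f (i + c))), sum_cc (fun c => kron (fun i => f (i - c))),
    ← Equiv.sum_comp (Equiv.neg (Fin n))]
  simp [sub_eq_add_neg]

theorem update_shift (f : Fin n → Mat2) (l k : ℕ) (A : Mat2) :
    (fun i => Function.update f (cc n k) A (i - cc n l)) =
      Function.update (fun i => f (i - cc n l)) (cc n (l + k)) A := by
  ext1 i
  by_cases h : i = cc n (l + k)
  · subst h; simp [cc_add]
  · have : i - cc n l ≠ cc n k := by
      intro h2; apply h; rw [cc_add, ← h2]; abel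
    simp [h, this]

theorem T_mul_pauli (f : Fin n → Mat2) (l k : ℕ) (A : Mat2) :
    T f l * pauliAt n A (cc n (l + k)) = T (Function.update f (cc n k) (f (cc n k) * A)) l := by
  simp only [T]
  rw [kron_mul_pauli, update_shift]
  simp [cc_add]

theorem pauli_mul_T (f : Fin n → Mat2) (l k : ℕ) (A : Mat2) :
    pauliAt n A (cc n (l + k)) * T f l = T (Function.update f (cc n k) (A * f (cc n k))) l := by
  simp only [T]
  rw [pauli_mul_kron, update_shift]
  simp [cc_add]

theorem T_update_smul (f : Fin n → Mat2) (l k : ℕ) (c : ℂ) (A : Mat2) :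
    T (Function.update f (cc n k) (c • A)) l = c • T (Function.update f (cc n k) A) l := by
  simp only [T, update_shift, kron_update_smul]

theorem T_anti (f : Fin n → Mat2) (l k : ℕ) (A : Mat2)
    (h : A * f (cc n k) = -(f (cc n k) * A)) :
    pauliAt n A (cc n (l + k)) * T f l = -(T f l * pauliAt n A (cc n (l + k))) := by
  simp only [T]
  apply pauli_anti
  simpa [cc_add] using h

/-! The generators. -/

def xg (n : ℕ) [NeZero n] (l : ℕ) : M n := pauliAt n sx (cc n l)
def zg (n : ℕ) [NeZero n] (l : ℕ) : M n := pauliAt n sz (cc n l)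
def hg (n : ℕ) [NeZero n] (l : ℕ) : M n := zg n l * zg n (l + 1)

theorem H1_eq : H1 n = ∑ l ∈ Finset.range n, xg n l := by
  simp only [H1, xg]
  rw [sum_cc (fun j => pauliAt n sx j)]

theorem H0_eq : H0 n = ∑ l ∈ Finset.range n, hg n l := by
  simp only [H0, hg, zg, cc_add]
  rw [sum_cc (fun j => pauliAt n sz j * pauliAt n sz (j + cc n 1))]
  simp only [finRotate_cc]

theorem xg_sq (l : ℕ) : xg n l * xg n l = 1 := by
  simp only [xg, pauli_mul_same, sx_sx, pauli_one]

theorem zg_sq (l : ℕ) : zg n l * zg n l = 1 := by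
  simp only [zg, pauli_mul_same, sz_sz, pauli_one]

theorem zg_comm (l k : ℕ) : zg n l * zg n k = zg n k * zg n l := by
  by_cases h : cc n l = cc n k
  · simp only [zg, h]
  · exact pauli_comm h _ _

theorem xg_comm (l k : ℕ) : xg n l * xg n k = xg n k * xg n l := by
  by_cases h : cc n l = cc n k
  · simp only [xg, h]
  · exact pauli_comm h _ _

theorem hg_sq (l : ℕ) : hg n l * hg n l = 1 := by
  have : hg n l * hg n l = zg n l * (zg n (l + 1) * zg n l) * zg n (l + 1) := by
    simp only [hg]; noncomm_ring
  rw [this, zg_comm (l + 1) l, ← mul_assoc, zg_sq, one_mul, zg_sq]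

theorem hg_comm (l k : ℕ) : hg n l * hg n k = hg n k * hg n l := by
  have c : ∀ i j, Commute (zg n i) (zg n j) := fun i j => zg_comm i j
  exact ((c l k).mul_right (c l (k + 1))).mul_left ((c (l + 1) k).mul_right (c (l + 1) (k + 1)))

theorem zx_anti (l : ℕ) : zg n l * xg n l = -(xg n l * zg n l) := by
  simp only [zg, xg, pauli_mul_same]
  rw [sz_sx_neg, ← neg_one_smul ℂ, pauli_smul, neg_one_smul]

theorem cc_ne_succ (hn : 3 ≤ n) (l : ℕ) : cc n l ≠ cc n (l + 1) := by
  rw [cc_add]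
  intro h
  have h1 : cc n 1 = 0 := by simpa using h.symm
  have := congrArg Fin.val h1
  rw [cc_val, Nat.mod_eq_of_lt (by omega)] at this
  simp at this

theorem zx_succ (hn : 3 ≤ n) (l : ℕ) : zg n l * xg n (l + 1) = xg n (l + 1) * zg n l :=
  pauli_comm (cc_ne_succ hn l) _ _

theorem xz_succ (hn : 3 ≤ n) (l : ℕ) : xg n l * zg n (l + 1) = zg n (l + 1) * xg n l :=
  pauli_comm (cc_ne_succ hn l) _ _

theorem hx_anti (hn : 3 ≤ n) (l : ℕ) : hg n l * xg n l = -(xg n l * hg n l) := by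
  simp only [hg]
  rw [mul_assoc, ← xz_succ hn, ← mul_assoc, zx_anti]
  noncomm_ring

theorem hx_anti' (hn : 3 ≤ n) (l : ℕ) : hg n l * xg n (l + 1) = -(xg n (l + 1) * hg n l) := by
  simp only [hg]
  rw [mul_assoc, zx_anti, ← mul_assoc, mul_neg, ← mul_assoc, zx_succ hn]

theorem H0_hg (k : ℕ) : H0 n * hg n k - hg n k * H0 n = 0 := by
  rw [H0_eq, Finset.sum_mul, Finset.mul_sum, ← Finset.sum_sub_distrib]
  exact Finset.sum_eq_zero fun l _ => by rw [hg_comm, sub_self]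

theorem H1_xg (k : ℕ) : H1 n * xg n k - xg n k * H1 n = 0 := by
  rw [H1_eq, Finset.sum_mul, Finset.mul_sum, ← Finset.sum_sub_distrib]
  exact Finset.sum_eq_zero fun l _ => by rw [xg_comm, sub_self]

theorem H1_zg (k : ℕ) : H1 n * zg n k - zg n k * H1 n = 2 * (xg n k * zg n k) := by
  simp only [H1]
  rw [Finset.sum_mul, Finset.mul_sum, ← Finset.sum_sub_distrib,
    Finset.sum_eq_single_of_mem (cc n k) (Finset.mem_univ _)]
  · have := zx_anti (n := n) k
    simp only [xg, zg] at *
    rw [this]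
    noncomm_ring
  · intro j _ hj
    rw [zg, pauli_comm hj, sub_self]

theorem H1_hg (k : ℕ) (hn : 3 ≤ n) :
    H1 n * hg n k - hg n k * H1 n = 2 * (xg n k + xg n (k + 1)) * hg n k := by
  have : H1 n * hg n k - hg n k * H1 n = (H1 n * zg n k - zg n k * H1 n) * zg n (k + 1)
      + zg n k * (H1 n * zg n (k + 1) - zg n (k + 1) * H1 n) := by
    simp only [hg]; noncomm_ring
  rw [this, H1_zg, H1_zg]
  have e : zg n k * (2 * (xg n (k + 1) * zg n (k + 1)))
      = 2 * ((zg n k * xg n (k + 1)) * zg n (k + 1)) := by noncomm_ring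
  rw [e, zx_succ hn, hg]
  noncomm_ring

theorem H0_xg (k : ℕ) (hn : 3 ≤ n) :
    H0 n * xg n (k + 1) - xg n (k + 1) * H0 n
      = 2 * (hg n k + hg n (k + 1)) * xg n (k + 1) := by
  have hz : ∀ l m : Fin n, pauliAt n sz l * pauliAt n sx m - pauliAt n sx m * pauliAt n sz l
      = if l = m then 2 * (pauliAt n sz m * pauliAt n sx m) else 0 := by
    intro l m
    split_ifs with h
    · subst h
      have := zx_anti (n := n) (l : ℕ)
      simp only [xg, zg, cc_coe] at this
      rw [this]; noncomm_ring
    · rw [pauli_comm h, sub_self]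
  have e : H0 n = ∑ j : Fin n, pauliAt n sz j * pauliAt n sz (j + cc n 1) := by
    simp only [H0, finRotate_cc]
  rw [e, Finset.sum_mul, Finset.mul_sum, ← Finset.sum_sub_distrib]
  have e2 : ∀ j : Fin n, pauliAt n sz j * pauliAt n sz (j + cc n 1) * xg n (k + 1)
      - xg n (k + 1) * (pauliAt n sz j * pauliAt n sz (j + cc n 1))
      = (if j = cc n (k + 1) then
          2 * (zg n (k + 1) * xg n (k + 1)) * pauliAt n sz (j + cc n 1) else 0)
      + (if j = cc n k then pauliAt n sz j * (2 * (zg n (k + 1) * xg n (k + 1))) else 0) := by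
    intro j
    have e3 : (j = cc n k) ↔ (j + cc n 1 = cc n (k + 1)) := by
      rw [cc_add]; simp
    have : pauliAt n sz j * pauliAt n sz (j + cc n 1) * xg n (k + 1)
      - xg n (k + 1) * (pauliAt n sz j * pauliAt n sz (j + cc n 1))
      = (pauliAt n sz j * xg n (k + 1) - xg n (k + 1) * pauliAt n sz j) * pauliAt n sz (j + cc n 1)
      + pauliAt n sz j * (pauliAt n sz (j + cc n 1) * xg n (k + 1)
        - xg n (k + 1) * pauliAt n sz (j + cc n 1)) := by noncomm_ring
    rw [this]
    simp only [xg, zg, e3, hz]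
    rw [ite_mul, mul_ite, zero_mul, mul_zero]
  rw [Finset.sum_congr rfl (fun j _ => e2 j), Finset.sum_add_distrib]
  simp only [Finset.sum_ite_eq', Finset.mem_univ, if_true]
  have e4 : pauliAt n sz (cc n (k + 1) + cc n 1) = zg n (k + 1 + 1) := by rw [zg, ← cc_add]
  have e5 : pauliAt n sz (cc n k) = zg n k := rfl
  rw [e4, e5]
  have e6 : 2 * (zg n (k + 1) * xg n (k + 1)) * zg n (k + 1 + 1)
    = 2 * (zg n (k + 1) * (xg n (k + 1) * zg n (k + 1 + 1))) := by noncomm_ring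
  rw [e6, xz_succ hn]
  simp only [hg]
  noncomm_ring

/-! Strings. -/

def Gx (n : ℕ) [NeZero n] (l k : ℕ) : M n := W (xg n) (hg n) l k
def Gh (n : ℕ) [NeZero n] (l k : ℕ) : M n := W (hg n) (fun i => xg n (i + 1)) l k

theorem xg_add_n (l : ℕ) : xg n (l + n) = xg n l := by simp only [xg, cc_add_n]
theorem hg_add_n (l : ℕ) : hg n (l + n) = hg n l := by
  simp only [hg, zg, cc_add_n, add_right_comm l n 1]

theorem Gx_n (k : ℕ) : Gx n n k = Gx n 0 k := by
  have hx : ∀ l, xg n (n + l) = xg n (0 + l) := fun l => by rw [add_comm, xg_add_n, zero_add]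
  have hh : ∀ l, hg n (n + l) = hg n (0 + l) := fun l => by rw [add_comm, hg_add_n, zero_add]
  simp only [Gx]
  induction k with
  | zero => exact hx 0
  | succ k ih => simp only [W]; rw [ih, hh, add_assoc, hx, add_assoc]

theorem Gh_n (k : ℕ) : Gh n n k = Gh n 0 k := by
  have hx : ∀ l, xg n (n + l) = xg n (0 + l) := fun l => by rw [add_comm, xg_add_n, zero_add]
  have hh : ∀ l, hg n (n + l) = hg n (0 + l) := fun l => by rw [add_comm, hg_add_n, zero_add]
  simp only [Gh]
  induction k with
  | zero => exact hh 0
  | succ k ih => simp only [W]; rw [ih, add_assoc, hx, add_assoc, hh]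

theorem H0_Gx (hn : 3 ≤ n) (l k : ℕ) :
    H0 n * Gx n (l + 1) k - Gx n (l + 1) k * H0 n
      = 2 * (hg n l * Gx n (l + 1) k) - 2 * (Gx n (l + 1) k * hg n (l + 1 + k)) :=
  W_comm _ _ _ H0_hg hg_sq (fun k => H0_xg k hn) (hx_anti hn) l k

theorem H1_Gh (hn : 3 ≤ n) (l k : ℕ) :
    H1 n * Gh n (l + 1) k - Gh n (l + 1) k * H1 n
      = 2 * (xg n (l + 1) * Gh n (l + 1) k) - 2 * (Gh n (l + 1) k * xg n (l + 1 + k + 1)) := by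
  refine W_comm (hg n) (fun i => xg n (i + 1)) _ (fun k => H1_xg _) (fun k => xg_sq _)
    (fun k => H1_hg _ hn) (fun k => ?_) l k
  rw [hx_anti' hn, neg_neg]

theorem Gh_succ (l k : ℕ) : Gh n l (k + 1) = hg n l * Gx n (l + 1) k * hg n (l + 1 + k) := by
  have := W_succ_left (xg n) (hg n) l k
  simp only [Gh, Gx, W]
  rw [this, add_right_comm l 1 k]

theorem Gx_succ (l k : ℕ) : Gx n l (k + 1) = xg n l * Gh n l k * xg n (l + k + 1) :=
  W_dual2 _ _ _ _

def ss (n : ℕ) [NeZero n] (k : ℕ) : M n := ∑ l ∈ Finset.range n, Gx n l k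
def tt (n : ℕ) [NeZero n] (k : ℕ) : M n := ∑ l ∈ Finset.range n, Gh n l k
def dd (n : ℕ) [NeZero n] : ℕ → M n
  | 0 => 0
  | k + 1 => ∑ l ∈ Finset.range n, (xg n l * Gh n l k - Gh n l k * xg n (l + k + 1))

theorem ss_eq (k : ℕ) : ss n k = ∑ l ∈ Finset.range n, Gx n (l + 1) k :=
  (sum_shift n (fun l => Gx n l k) (Gx_n k)).symm
theorem tt_eq (k : ℕ) : tt n k = ∑ l ∈ Finset.range n, Gh n (l + 1) k :=
  (sum_shift n (fun l => Gh n l k) (Gh_n k)).symm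

theorem dd_eq (k : ℕ) : dd n (k + 1) = ∑ l ∈ Finset.range n,
    (xg n (l + 1) * Gh n (l + 1) k - Gh n (l + 1) k * xg n (l + 1 + k + 1)) := by
  refine (sum_shift n (fun l => xg n l * Gh n l k - Gh n l k * xg n (l + k + 1)) ?_).symm
  have h1 := xg_add_n (n := n) 0
  have h2 := xg_add_n (n := n) (0 + k + 1)
  simp only [zero_add] at h1 h2 ⊢
  rw [Gh_n, h1, add_assoc, add_comm n, h2]

theorem dd_eq2 (k : ℕ) : dd n (k + 1) = ∑ l ∈ Finset.range n,
    (Gx n (l + 1) k * hg n (l + 1 + k) - hg n l * Gx n (l + 1) k) := by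
  have a : ∀ l, xg n l * Gh n l k = Gx n l k * hg n (l + k) := fun l =>
    (W_dual (xg n) (hg n) l k).symm
  have b : ∀ l, Gh n l k * xg n (l + k + 1) = hg n l * Gx n (l + 1) k := fun l =>
    W_succ_left (xg n) (hg n) l k
  simp only [dd]
  rw [Finset.sum_sub_distrib, Finset.sum_sub_distrib]
  simp only [a, b]
  congr 1
  refine (sum_shift n (fun l => Gx n l k * hg n (l + k)) ?_).symm
  have h2 := hg_add_n (n := n) k
  simp only [zero_add]
  rw [Gx_n, add_comm, h2]

theorem comm_sum (H : M n) (f : ℕ → M n) : H * (∑ l ∈ Finset.range n, f l)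
    - (∑ l ∈ Finset.range n, f l) * H = ∑ l ∈ Finset.range n, (H * f l - f l * H) := by
  rw [Finset.sum_mul, Finset.mul_sum, ← Finset.sum_sub_distrib]

theorem H0_ss (hn : 3 ≤ n) (k : ℕ) : H0 n * ss n k - ss n k * H0 n = (-2) * dd n (k + 1) := by
  rw [ss_eq, comm_sum, dd_eq2, Finset.mul_sum]
  refine Finset.sum_congr rfl fun l _ => ?_
  rw [H0_Gx hn]
  noncomm_ring

theorem H1_tt (hn : 3 ≤ n) (k : ℕ) : H1 n * tt n k - tt n k * H1 n = 2 * dd n (k + 1) := by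
  rw [tt_eq, comm_sum, dd_eq, Finset.mul_sum]
  refine Finset.sum_congr rfl fun l _ => ?_
  rw [H1_Gh hn]
  noncomm_ring

theorem sandwich {R : Type*} [Ring R] (H a g b : R) (ha : H * a - a * H = 0)
    (hb : H * b - b * H = 0) :
    H * (a * g * b) - a * g * b * H = a * (H * g - g * H) * b := by
  have : H * (a * g * b) - a * g * b * H = (H * a - a * H) * g * b + a * (H * g - g * H) * b
    + a * g * (H * b - b * H) := by noncomm_ring
  rw [this, ha, hb]; noncomm_ring

theorem sandwich2 {R : Type*} [Ring R] (a g b : R) (ha : a * a = 1) (hb : b * b = 1) :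
    a * (2 * (a * g) - 2 * (g * b)) * b = 2 * (g * b) - 2 * (a * g) := by
  have : a * (2 * (a * g) - 2 * (g * b)) * b = 2 * ((a * a) * g * b) - 2 * (a * g * (b * b)) := by
    noncomm_ring
  rw [this, ha, hb]; noncomm_ring

theorem diffs {R : Type*} [Ring R] (H a g b : R) (ha : H * a - a * H = 0)
    (hb : H * b - b * H = 0) (haa : a * a = 1) (hbb : b * b = 1)
    (hg : H * g - g * H = 2 * (a * g) - 2 * (g * b)) :
    H * (a * g - g * b) - (a * g - g * b) * H = 4 * (g - a * g * b) := by
  have : H * (a * g - g * b) - (a * g - g * b) * H =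
    (H * a - a * H) * g + a * (H * g - g * H) - (H * g - g * H) * b - g * (H * b - b * H) := by
    noncomm_ring
  rw [this, ha, hb, hg]
  have : 0 * g + a * (2 * (a * g) - 2 * (g * b)) - (2 * (a * g) - 2 * (g * b)) * b - g * 0 =
    2 * ((a * a) * g) - 4 * (a * g * b) + 2 * (g * (b * b)) := by noncomm_ring
  rw [this, haa, hbb]
  noncomm_ring

theorem H0_tt (hn : 3 ≤ n) (k : ℕ) : H0 n * tt n k - tt n k * H0 n = 2 * dd n k := by
  cases k with
  | zero =>
    simp only [tt, dd, mul_zero]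
    rw [comm_sum]
    exact Finset.sum_eq_zero fun l _ => H0_hg l
  | succ k =>
    rw [tt, comm_sum, dd_eq2, Finset.mul_sum]
    refine Finset.sum_congr rfl fun l _ => ?_
    rw [Gh_succ, sandwich _ _ _ _ (H0_hg _) (H0_hg _), H0_Gx hn, sandwich2 _ _ _ (hg_sq _) (hg_sq _),
      mul_sub]

theorem H1_ss (hn : 3 ≤ n) (k : ℕ) : H1 n * ss n k - ss n k * H1 n = (-2) * dd n k := by
  cases k with
  | zero =>
    simp only [ss, dd, mul_zero]
    rw [comm_sum]
    exact Finset.sum_eq_zero fun l _ => H1_xg l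
  | succ k =>
    rw [ss_eq, comm_sum, dd_eq, Finset.mul_sum]
    refine Finset.sum_congr rfl fun l _ => ?_
    rw [Gx_succ, sandwich _ _ _ _ (H1_xg _) (H1_xg _), H1_Gh hn, sandwich2 _ _ _ (xg_sq _) (xg_sq _)]
    noncomm_ring

theorem H0_dd (hn : 3 ≤ n) (k : ℕ) :
    H0 n * dd n (k + 1) - dd n (k + 1) * H0 n = 4 * (tt n (k + 1) - ss n k) := by
  rw [tt, ss_eq, dd_eq2, comm_sum, ← Finset.sum_sub_distrib, Finset.mul_sum]
  refine Finset.sum_congr rfl fun l _ => ?_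
  have := diffs (H0 n) (hg n l) (Gx n (l + 1) k) (hg n (l + 1 + k)) (H0_hg _) (H0_hg _) (hg_sq _)
    (hg_sq _) (H0_Gx hn l k)
  rw [Gh_succ]
  have e : H0 n * (Gx n (l + 1) k * hg n (l + 1 + k) - hg n l * Gx n (l + 1) k)
    - (Gx n (l + 1) k * hg n (l + 1 + k) - hg n l * Gx n (l + 1) k) * H0 n
    = -(H0 n * (hg n l * Gx n (l + 1) k - Gx n (l + 1) k * hg n (l + 1 + k))
      - (hg n l * Gx n (l + 1) k - Gx n (l + 1) k * hg n (l + 1 + k)) * H0 n) := by noncomm_ring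
  rw [e, this]
  noncomm_ring

theorem H1_dd (hn : 3 ≤ n) (k : ℕ) :
    H1 n * dd n (k + 1) - dd n (k + 1) * H1 n = 4 * (tt n k - ss n (k + 1)) := by
  rw [tt_eq, ss_eq, dd_eq, comm_sum, ← Finset.sum_sub_distrib, Finset.mul_sum]
  refine Finset.sum_congr rfl fun l _ => ?_
  rw [diffs (H1 n) _ _ _ (H1_xg _) (H1_xg _) (xg_sq _) (xg_sq _) (H1_Gh hn l k), Gx_succ]

/-! Identification of the strings. -/

theorem eq_cc {k : ℕ} (hk : k < n) (i : Fin n) : i = cc n k ↔ (i : ℕ) = k := by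
  rw [Fin.ext_iff, cc_val, Nat.mod_eq_of_lt hk]

def sf (n : ℕ) (a b : Mat2) (j : ℕ) : Fin n → Mat2 :=
  fun i => if (i : ℕ) = 0 then a else if (i : ℕ) = j + 1 then b
    else if (i : ℕ) ≤ j then sx else 1

theorem str_eq (a b : Mat2) (k : ℕ) : str n a b k = kron (sf n a b k) := rfl

theorem T_one (l : ℕ) : T (fun _ : Fin n => (1 : Mat2)) l = 1 := kron_one

theorem zxz : sz * sx * sz = (-1 : ℂ) • sx := by
  rw [sz_sx_neg, neg_mul, mul_assoc, sz_sz, mul_one, neg_one_smul]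

theorem cc_val' {k : ℕ} (hk : k < n) : ((cc n k : Fin n) : ℕ) = k := by
  rw [cc_val, Nat.mod_eq_of_lt hk]

theorem Gh_T (l k : ℕ) (hk : k + 1 < n) : Gh n l k = (-1 : ℂ) ^ k • T (sf n sz sz k) l := by
  induction k with
  | zero =>
    have e : Gh n l 0 = T (fun _ : Fin n => (1 : Mat2)) l * pauliAt n sz (cc n (l + 0))
      * pauliAt n sz (cc n (l + 1)) := by
      rw [T_one, one_mul]; rfl
    rw [e, T_mul_pauli, T_mul_pauli, pow_zero, one_smul]
    congr 1
    ext1 i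
    simp only [Function.update_apply, eq_cc hk, eq_cc (show 0 < n by omega), sf, cc_val' hk]
    split_ifs <;> first | contradiction | omega | rfl | simp
  | succ k ih =>
    have e : Gh n l (k + 1) = Gh n l k * pauliAt n sx (cc n (l + (k + 1)))
      * pauliAt n sz (cc n (l + (k + 1))) * pauliAt n sz (cc n (l + (k + 2))) := by
      simp only [mul_assoc]; simp only [Gh, W, mul_assoc]; rfl
    have e1 : sf n sz sz k (cc n (k + 1)) = sz := by
      simp [sf, cc_val' (show k + 1 < n by omega)]
    rw [e, ih (by omega), smul_mul_assoc, smul_mul_assoc, smul_mul_assoc, T_mul_pauli, T_mul_pauli,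
      Function.update_self, Function.update_idem, e1, zxz, T_update_smul, smul_mul_assoc, smul_smul,
      ← pow_succ, T_mul_pauli]
    congr 2
    ext1 i
    simp only [Function.update_apply, eq_cc hk, eq_cc (show k + 1 < n by omega), sf, cc_val' hk]
    split_ifs <;> first | contradiction | omega | rfl | simp

def xxf (n : ℕ) : Fin n → Mat2 := fun i => if (i : ℕ) = n - 1 then 1 else sx

theorem Gh_last (l : ℕ) (hn : 3 ≤ n) :
    Gh n l (n - 1) = (-1 : ℂ) ^ (n - 1) • T (xxf n) (l + 1) := by
  obtain ⟨k, rfl⟩ : ∃ k, n = k + 2 := ⟨n - 2, by omega⟩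
  have e : Gh (k + 2) l (k + 1) = Gh (k + 2) l k * pauliAt (k + 2) sx (cc (k + 2) (l + (k + 1)))
    * pauliAt (k + 2) sz (cc (k + 2) (l + (k + 1)))
    * pauliAt (k + 2) sz (cc (k + 2) (l + (k + 2))) := by
    simp only [mul_assoc]; simp only [Gh, W, mul_assoc]; rfl
  have e1 : sf (k + 2) sz sz k (cc (k + 2) (k + 1)) = sz := by
    simp [sf, cc_val' (show k + 1 < k + 2 by omega)]
  have e0 : cc (k + 2) (k + 2) = cc (k + 2) 0 := by rw [cc_n, cc_zero]
  have e2 : k + 2 - 1 = k + 1 := rfl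
  have e3 : T (xxf (k + 2)) (l + 1) = T (fun i => if (i : ℕ) = 0 then 1 else sx) l := by
    simp only [T]
    congr 1
    ext1 i
    have : i - cc (k + 2) (l + 1) = (i - cc (k + 2) l) - cc (k + 2) 1 := by
      rw [cc_add]; abel
    rw [this]
    generalize i - cc (k + 2) l = j
    have h : ((j - cc (k + 2) 1 : Fin (k + 2)) : ℕ) = k + 2 - 1 ↔ (j : ℕ) = 0 := by
      rw [e2, ← eq_cc (show k + 1 < k + 2 by omega), sub_eq_iff_eq_add, ← cc_add]
      change j = cc (k + 2) (k + 2) ↔ _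
      rw [e0, eq_cc (by omega)]
    simp only [xxf, h]
  rw [e2, e, Gh_T l k (by omega), smul_mul_assoc, smul_mul_assoc, smul_mul_assoc, T_mul_pauli,
    T_mul_pauli, Function.update_self, Function.update_idem, e1, zxz, T_update_smul,
    smul_mul_assoc, smul_smul, ← pow_succ, T_mul_pauli, e0, e3]
  congr 2
  ext1 i
  have hi := i.2
  simp only [Function.update_apply, eq_cc (show k + 1 < k + 2 by omega),
    eq_cc (show 0 < k + 2 by omega), sf, cc_val' (show 0 < k + 2 by omega)]
  split_ifs <;> first | contradiction | omega | rfl | simp [sz_sz]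

theorem T_sf_right (a b b' : Mat2) (c : ℂ) (l k : ℕ) (hk : k + 1 < n) (h : b * sx = c • b') :
    T (sf n a b k) l * xg n (l + k + 1) = c • T (sf n a b' k) l := by
  have e1 : sf n a b k (cc n (k + 1)) = b := by simp [sf, cc_val' hk]
  rw [xg, add_assoc, T_mul_pauli, e1, h, T_update_smul]
  congr 2
  ext1 i
  simp only [Function.update_apply, eq_cc hk, sf]
  split_ifs <;> first | contradiction | omega | rfl

theorem T_sf_left (a b a' : Mat2) (c : ℂ) (l k : ℕ) (hk : k + 1 < n) (h : sx * a = c • a') :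
    xg n l * T (sf n a b k) l = c • T (sf n a' b k) l := by
  have e1 : sf n a b k (cc n 0) = a := by simp [sf, cc_val' (show 0 < n by omega)]
  have := pauli_mul_T (sf n a b k) l 0 sx
  rw [add_zero] at this
  rw [xg, this, e1, h, T_update_smul]
  congr 2
  ext1 i
  simp only [Function.update_apply, eq_cc (show 0 < n by omega), sf]
  split_ifs <;> first | contradiction | omega | rfl

theorem Gx_T (l k : ℕ) (hk : k + 1 < n) :
    Gx n l (k + 1) = (-1 : ℂ) ^ k • T (sf n sy sy k) l := by
  rw [Gx_succ, Gh_T l k hk, mul_smul_comm, smul_mul_assoc, T_sf_left _ _ _ _ _ _ hk sx_sz,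
    smul_mul_assoc, T_sf_right _ _ _ _ _ _ hk sz_sx, smul_smul Complex.I]
  simp

theorem ss_zero : X n = Complex.I • ss n 0 := by
  rw [X, symmC_kron, ss]
  congr 1
  refine Finset.sum_congr rfl fun l _ => ?_
  simp only [T, Gx, W, xg, pauliAt]
  congr 1
  ext1 i
  have : ((i - cc n l : Fin n) : ℕ) = 0 ↔ i = cc n l := by
    rw [← eq_cc (NeZero.pos n), cc_zero, sub_eq_zero]
  simp only [this]

theorem neg_one_sq_smul (k : ℕ) (A : M n) : (-1 : ℂ) ^ k • (-1 : ℂ) ^ k • A = A := by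
  rw [smul_smul, ← mul_pow]; simp

theorem Y_eq (k : ℕ) (hk : k + 1 < n) :
    Y n k = (-1 : ℂ) ^ k • Complex.I • ss n (k + 1) := by
  rw [Y, str_eq, symmC_kron, ss, smul_comm]
  congr 1
  rw [Finset.smul_sum]
  exact Finset.sum_congr rfl fun l _ => by rw [Gx_T l k hk, neg_one_sq_smul]

theorem Z_eq (k : ℕ) (hk : k + 1 < n) :
    Z n k = (-1 : ℂ) ^ k • Complex.I • tt n k := by
  rw [Z, str_eq, symmC_kron, tt, smul_comm]
  congr 1
  rw [Finset.smul_sum]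
  exact Finset.sum_congr rfl fun l _ => by rw [Gh_T l k hk, neg_one_sq_smul]

theorem XX_eq (hn : 3 ≤ n) : XX n = (-1 : ℂ) ^ (n - 1) • Complex.I • tt n (n - 1) := by
  rw [XX, show (fun i : Fin n => if (i : ℕ) = n - 1 then 1 else sx) = xxf n from rfl, symmC_kron, tt, smul_comm]
  congr 1
  rw [Finset.smul_sum, ← sum_shift n (T (xxf n)) (by simp only [T, cc_n, cc_zero])]
  exact Finset.sum_congr rfl fun l _ => by rw [Gh_last l hn, neg_one_sq_smul]

theorem YZ_eq (k : ℕ) (hk : k + 1 < n) : YZ n k = (-1 : ℂ) ^ k • dd n (k + 1) := by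
  rw [YZ, str_eq, str_eq, symmC_kron, symmC_kron, dd, ← smul_add, ← Finset.sum_add_distrib,
    Finset.smul_sum, Finset.smul_sum]
  refine Finset.sum_congr rfl fun l _ => ?_
  rw [Gh_T l k hk, mul_smul_comm, smul_mul_assoc, T_sf_left _ _ _ _ _ _ hk sx_sz,
    T_sf_right _ _ _ _ _ _ hk sz_sx, ← smul_sub, neg_one_sq_smul, neg_smul, sub_neg_eq_add,
    ← smul_add, add_comm]

theorem dd_last (hn : 3 ≤ n) : dd n n = 0 := by
  obtain ⟨k, hk⟩ : ∃ k, n = k + 2 := ⟨n - 2, by omega⟩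
  have e : dd n n = dd n (k + 1 + 1) := congrArg (dd n) hk
  rw [e, dd_eq2]
  refine Finset.sum_eq_zero fun l _ => ?_
  have hl : l + 1 + (k + 1) = l + n := by omega
  rw [hl, hg_add_n, Gx_T _ _ (by omega), smul_mul_assoc, mul_smul_comm]
  have e0 : l + 1 = l + 1 + 0 := rfl
  have a1 := T_anti (sf n sy sy k) (l + 1) 0 sz (by
    simp [sf, cc_val' (show 0 < n by omega), sz_sy_neg])
  have a2 := T_anti (sf n sy sy k) (l + 1) (k + 1) sz (by
    simp [sf, cc_val' (show k + 1 < n by omega), sz_sy_neg])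
  rw [hl, cc_add_n] at a2
  have : hg n l * T (sf n sy sy k) (l + 1) = T (sf n sy sy k) (l + 1) * hg n l := by
    simp only [hg, zg]
    rw [add_zero] at a1
    rw [mul_assoc, a1, mul_neg, ← mul_assoc, a2, neg_mul, neg_neg, mul_assoc]
  rw [this, sub_self]

/-! The ideal. -/

def bb (lam : ℝ) (k : ℕ) : ℝ := (-1) ^ k * aSeq lam k

theorem bb_rec (lam : ℝ) (k : ℕ) : bb lam (k + 2) = -lam * bb lam (k + 1) - bb lam k := by
  simp only [bb, aSeq]; ring

theorem smul_bb (lam : ℝ) (k : ℕ) (A : M n) :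
    aSeq lam k • (-1 : ℂ) ^ k • A = bb lam k • A := by
  have : (-1 : ℂ) ^ k • A = ((-1 : ℝ) ^ k) • A := by
    rcases neg_one_pow_eq_or ℂ k with h | h <;> rcases Nat.even_or_odd k with h2 | h2 <;>
      simp [h2.neg_one_pow]
  rw [this, smul_smul, bb, mul_comm]

theorem Zhat_eq (lam : ℝ) :
    Zhat n lam = ∑ k ∈ Finset.range (n - 1), bb lam k • dd n (k + 1) := by
  rw [Zhat]
  refine Finset.sum_congr rfl fun k hk => ?_
  rw [Finset.mem_range] at hk
  rw [YZ_eq k (by omega), smul_bb]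

theorem Yhat_eq (lam : ℝ) :
    Yhat n lam = ∑ k ∈ Finset.range (n - 1), bb lam k • Complex.I • (ss n (k + 1) - tt n k) := by
  rw [Yhat]
  refine Finset.sum_congr rfl fun k hk => ?_
  rw [Finset.mem_range] at hk
  rw [Y_eq k (by omega), Z_eq k (by omega), ← smul_sub, ← smul_sub, smul_bb]

theorem Xhat_eq (hn : 3 ≤ n) (lam : ℝ) :
    Xhat n lam = ∑ k ∈ Finset.range (n - 1), bb lam k • Complex.I • (ss n k - tt n (k + 1)) := by
  obtain ⟨m, hm⟩ : ∃ m, n = m + 3 := ⟨n - 3, by omega⟩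
  have e1 : n - 1 = m + 1 + 1 := by omega
  have e2 : n - 2 = m + 1 := by omega
  have e3 : n - 3 = m := by omega
  rw [Xhat, XX_eq hn, e1, e2, e3, Finset.sum_range_succ, Finset.sum_range_succ', ss_zero,
    Z_eq 1 (by omega), Y_eq m (by omega), Finset.range_eq_Ico, Finset.sum_Ico_add' (fun k =>
      bb lam k • Complex.I • (ss n k - tt n (k + 1))) 0 m 1]
  have e4 : (-1 : ℂ) ^ (m + 1 + 1) • Complex.I • tt n (m + 1 + 1)
      - (-1 : ℂ) ^ m • Complex.I • ss n (m + 1)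
      = (-1 : ℂ) ^ (m + 1) • Complex.I • (ss n (m + 1) - tt n (m + 1 + 1)) := by
    simp only [pow_succ]; module
  have e5 : Complex.I • ss n 0 + (-1 : ℂ) ^ 1 • Complex.I • tt n 1
      = bb lam 0 • Complex.I • (ss n 0 - tt n (0 + 1)) := by
    simp only [bb, aSeq, pow_zero, mul_one, one_smul, pow_one, zero_add]; module
  rw [e4, smul_bb, e5]
  have e6 : ∑ k ∈ Finset.Icc 1 m, aSeq lam k • (Z n (k + 1) - Y n (k - 1))
      = ∑ k ∈ Finset.Ico (0 + 1) (m + 1), bb lam k • Complex.I • (ss n k - tt n (k + 1)) := by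
    refine Finset.sum_congr (by ext; simp only [Finset.mem_Icc, Finset.mem_Ico]; omega) fun k hk => ?_
    rw [Finset.mem_Ico] at hk
    obtain ⟨j, rfl⟩ : ∃ j, k = j + 1 := ⟨k - 1, by omega⟩
    rw [Nat.add_sub_cancel, Z_eq _ (by omega), Y_eq _ (by omega), ← smul_bb]
    congr 1
    simp only [pow_succ]; module
  rw [e6]
  abel

theorem telescope (lam : ℝ) (N : ℕ) : ∑ k ∈ Finset.range (N + 1),
    bb lam k • (dd n k + dd n (k + 2)) = (-lam) • ∑ k ∈ Finset.range (N + 1),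
    bb lam k • dd n (k + 1) + bb lam N • dd n (N + 2) - bb lam (N + 1) • dd n (N + 1) := by
  induction N with
  | zero => simp [bb, aSeq, dd]
  | succ N ih =>
    rw [Finset.sum_range_succ, ih, Finset.sum_range_succ _ (N + 1), bb_rec]
    module

theorem telescope' (hn : 3 ≤ n) (lam : ℝ) (hroot : aSeq lam (n - 1) = 0) :
    ∑ k ∈ Finset.range (n - 1), bb lam k • (dd n k + dd n (k + 2)) = (-lam) • Zhat n lam := by
  obtain ⟨N, hN⟩ : ∃ N, n = N + 2 := ⟨n - 2, by omega⟩
  have e1 : n - 1 = N + 1 := by omega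
  have e2 : dd n (N + 2) = 0 := by rw [← dd_last hn]; exact congrArg (dd n) hN.symm
  rw [Zhat_eq, e1, telescope, e2, show bb lam (N + 1) = 0 by rw [bb, ← e1, hroot, mul_zero]]
  simp

theorem lie_sum_bb (H : M n) (lam : ℝ) (N : ℕ) (f : ℕ → M n) :
    ⁅Complex.I • H, ∑ k ∈ Finset.range N, bb lam k • f k⁆ =
      ∑ k ∈ Finset.range N, bb lam k • Complex.I • (H * f k - f k * H) := by
  rw [Ring.lie_def, Finset.sum_mul, Finset.mul_sum, ← Finset.sum_sub_distrib]
  refine Finset.sum_congr rfl fun k _ => ?_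
  rw [mul_smul_comm, smul_mul_assoc, smul_mul_assoc, mul_smul_comm, ← smul_sub, ← smul_sub]

theorem lie_I (H A B C : M n) (hA : H * A - A * H = B) (hC : Complex.I • Complex.I • B = C) :
    Complex.I • (H * (Complex.I • A) - (Complex.I • A) * H) = C := by
  rw [mul_smul_comm, smul_mul_assoc, ← smul_sub, hA, hC]

theorem I_I (A : M n) : Complex.I • Complex.I • A = -A := by
  rw [smul_smul, Complex.I_mul_I, neg_one_smul]

theorem two_mul_real (A : M n) : 2 * A = (2 : ℝ) • A := by
  rw [two_mul, two_smul]

theorem four_mul_real (A : M n) : 4 * A = (4 : ℝ) • A := by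
  rw [show (4 : M n) = 2 + 2 by norm_num, add_mul, two_mul_real]; module

theorem comm_sub (H A B : M n) : H * (A - B) - (A - B) * H
    = (H * A - A * H) - (H * B - B * H) := by
  noncomm_ring

theorem c1 (hn : 3 ≤ n) (lam : ℝ) :
    ⁅Complex.I • H0 n, Xhat n lam⁆ = (4 : ℝ) • Zhat n lam := by
  rw [Xhat_eq hn, lie_sum_bb, Zhat_eq, Finset.smul_sum]
  refine Finset.sum_congr rfl fun k _ => ?_
  rw [smul_comm (4 : ℝ)]
  congr 1
  refine lie_I _ _ _ _ rfl ?_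
  rw [I_I, comm_sub, H0_ss hn, H0_tt hn, neg_mul, two_mul_real]
  module

theorem c2 (hn : 3 ≤ n) (lam : ℝ) (hroot : aSeq lam (n - 1) = 0) :
    ⁅Complex.I • H1 n, Xhat n lam⁆ = (2 : ℝ) • (-lam) • Zhat n lam := by
  rw [← telescope' hn lam hroot, Xhat_eq hn, lie_sum_bb, Finset.smul_sum]
  refine Finset.sum_congr rfl fun k _ => ?_
  rw [smul_comm (2 : ℝ)]
  congr 1
  refine lie_I _ _ _ _ rfl ?_
  rw [I_I, comm_sub, H1_ss hn, H1_tt hn, neg_mul, two_mul_real, two_mul_real]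
  module

theorem c3 (hn : 3 ≤ n) (lam : ℝ) (hroot : aSeq lam (n - 1) = 0) :
    ⁅Complex.I • H0 n, Yhat n lam⁆ = (2 : ℝ) • (-lam) • Zhat n lam := by
  rw [← telescope' hn lam hroot, Yhat_eq, lie_sum_bb, Finset.smul_sum]
  refine Finset.sum_congr rfl fun k _ => ?_
  rw [smul_comm (2 : ℝ)]
  congr 1
  refine lie_I _ _ _ _ rfl ?_
  rw [I_I, comm_sub, H0_ss hn, H0_tt hn, neg_mul, two_mul_real, two_mul_real]
  module

theorem c4 (hn : 3 ≤ n) (lam : ℝ) :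
    ⁅Complex.I • H1 n, Yhat n lam⁆ = (4 : ℝ) • Zhat n lam := by
  rw [Yhat_eq, lie_sum_bb, Zhat_eq, Finset.smul_sum]
  refine Finset.sum_congr rfl fun k _ => ?_
  rw [smul_comm (4 : ℝ)]
  congr 1
  refine lie_I _ _ _ _ rfl ?_
  rw [I_I, comm_sub, H1_ss hn, H1_tt hn, neg_mul, two_mul_real]
  module

theorem c5 (hn : 3 ≤ n) (lam : ℝ) :
    ⁅Complex.I • H0 n, Zhat n lam⁆ = (-4 : ℝ) • Xhat n lam := by
  rw [Xhat_eq hn, Zhat_eq, lie_sum_bb, Finset.smul_sum]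
  refine Finset.sum_congr rfl fun k _ => ?_
  rw [smul_comm (-4 : ℝ), smul_comm (-4 : ℝ), H0_dd hn, four_mul_real]
  congr 2
  module

theorem c6 (hn : 3 ≤ n) (lam : ℝ) :
    ⁅Complex.I • H1 n, Zhat n lam⁆ = (-4 : ℝ) • Yhat n lam := by
  rw [Yhat_eq, Zhat_eq, lie_sum_bb, Finset.smul_sum]
  refine Finset.sum_congr rfl fun k _ => ?_
  rw [smul_comm (-4 : ℝ), smul_comm (-4 : ℝ), H1_dd hn, four_mul_real]
  congr 2
  module

theorem ideal_of_gens (n : ℕ) (lam : ℝ) (A : M n) (hx : ⁅A, Xhat n lam⁆ ∈ Ideal n lam)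
    (hy : ⁅A, Yhat n lam⁆ ∈ Ideal n lam) (hz : ⁅A, Zhat n lam⁆ ∈ Ideal n lam) :
    ∀ B ∈ Ideal n lam, ⁅A, B⁆ ∈ Ideal n lam := by
  intro B hB
  induction hB using Submodule.span_induction with
  | mem x h =>
    rcases h with rfl | rfl | rfl
    · exact hx
    · exact hy
    · exact hz
  | zero => rw [lie_zero]; exact Submodule.zero_mem _
  | add x y _ _ h1 h2 => rw [lie_add]; exact Submodule.add_mem _ h1 h2
  | smul c x _ h => rw [lie_smul]; exact Submodule.smul_mem _ _ h

end Helpers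

/-- For every `n ≥ 3` and every real root `λ̄` of `a_{n-1}`, the
subspace `I_λ̄ = span_ℝ {X̂, Ŷ, Ẑ}` is a Lie ideal of the dynamical Lie algebra,
i.e. `[ℒ, I_λ̄] ⊆ I_λ̄`. -/
theorem stmt10 (n : ℕ) (hn : 3 ≤ n) (lam : ℝ) (hroot : aSeq lam (n - 1) = 0) :
    ∀ A ∈ DLA n, ∀ B ∈ Ideal n lam, ⁅A, B⁆ ∈ Ideal n lam := by
  haveI : NeZero n := ⟨by omega⟩
  have mx : Xhat n lam ∈ Ideal n lam := Submodule.subset_span (by simp)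
  have my : Yhat n lam ∈ Ideal n lam := Submodule.subset_span (by simp)
  have mz : Zhat n lam ∈ Ideal n lam := Submodule.subset_span (by simp)
  intro A hA
  induction hA using LieSubalgebra.lieSpan_induction with
  | mem x h =>
    rcases h with rfl | rfl
    · apply ideal_of_gens
      · rw [c1 hn]; exact Submodule.smul_mem _ _ mz
      · rw [c3 hn lam hroot]; exact Submodule.smul_mem _ _ (Submodule.smul_mem _ _ mz)
      · rw [c5 hn]; exact Submodule.smul_mem _ _ mx
    · apply ideal_of_gens
      · rw [c2 hn lam hroot]; exact Submodule.smul_mem _ _ (Submodule.smul_mem _ _ mz)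
      · rw [c4 hn]; exact Submodule.smul_mem _ _ mz
      · rw [c6 hn]; exact Submodule.smul_mem _ _ my
  | zero => intro B _; rw [zero_lie]; exact Submodule.zero_mem _
  | add x y _ _ h1 h2 => intro B hB; rw [add_lie]; exact Submodule.add_mem _ (h1 B hB) (h2 B hB)
  | smul c x _ h => intro B hB; rw [smul_lie]; exact Submodule.smul_mem _ _ (h B hB)
  | lie x y _ _ h1 h2 =>
    intro B hB
    rw [lie_lie]
    exact Submodule.sub_mem _ (h1 _ (h2 B hB)) (h2 _ (h1 B hB))

end
end Ising
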